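/- Let $N \equiv 0 \pmod 4$, $m > N-1$, and let $q$ be the unique integer with $-2N+2 < m - q(N-1) < 2N-2$ and $m+q \equiv 2 \pmod 4$. Set $g(q) = (m+q)^2 N - q^2 N^2 - m N^2$. Then every $N$-run supersaturated design with $m$ factors (balanced $\pm 1$ columns, no two columns equal or opposite) satisfies: $E(s^2) \ge [g(q) + 2N^2 - 4N]/[m(m-1)]$ if $|m - q(N-1)| < N-1$; $E(s^2) \ge [g(q) - 2N^2 + 4N + 4N|m - q(N-1)|]/[m(m-1)]$ if $N-1 < |m - q(N-1)| \le \frac{3}{2}N - 2$; and $E(s^2) \ge [g(q) + 4N^2 - 4N]/[m(m-1)]$ if $|m - q(N-1)| > \frac{3}{2}N - 2$. -/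

import Mathlib

open Finset

/-- The sum of the squared entries is the same for the two Gram matrices of `X`. -/
theorem sum_sq_gram_comm {ι κ : Type*} [Fintype ι] [Fintype κ] (X : Matrix ι κ ℤ) :
    ∑ j, ∑ j', (∑ k, X k j * X k j') ^ 2 = ∑ i, ∑ i', (∑ j, X i j * X i' j) ^ 2 := by
  have h1 : ∑ j, ∑ j', (∑ k, X k j * X k j') ^ 2
      = ∑ j, ∑ j', ∑ k, ∑ l, X k j * X k j' * (X l j * X l j') := by
    simp_rw [sq, sum_mul_sum]
  have h2 : ∑ i, ∑ i', (∑ j, X i j * X i' j) ^ 2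
      = ∑ k, ∑ l, ∑ j, ∑ j', X k j * X k j' * (X l j * X l j') := by
    simp_rw [sq, sum_mul_sum]
    refine sum_congr rfl fun _ _ => sum_congr rfl fun _ _ => sum_congr rfl fun _ _ =>
      sum_congr rfl fun _ _ => by ring
  rw [h1, h2]
  calc _ = ∑ j, ∑ k, ∑ j', ∑ l, X k j * X k j' * (X l j * X l j') :=
        sum_congr rfl fun _ _ => sum_comm
    _ = ∑ k, ∑ j, ∑ j', ∑ l, X k j * X k j' * (X l j * X l j') := sum_comm
    _ = ∑ k, ∑ j, ∑ l, ∑ j', X k j * X k j' * (X l j * X l j') :=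
        sum_congr rfl fun _ _ => sum_congr rfl fun _ _ => sum_comm
    _ = _ := sum_congr rfl fun _ _ => sum_comm

/-- The full sum of a symmetric array is its diagonal plus twice its upper triangle. -/
theorem sum_sum_eq_diag_add_two_mul {n : ℕ} (f : Fin n → Fin n → ℤ)
    (hf : ∀ i j, f i j = f j i) :
    ∑ i, ∑ j, f i j = ∑ i, f i i
      + 2 * ∑ p ∈ (univ : Finset (Fin n × Fin n)).filter (fun p => p.1 < p.2), f p.1 p.2 := by
  have hs : ∑ p ∈ (univ : Finset (Fin n × Fin n)).filter (fun p => p.1 < p.2), f p.1 p.2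
      = ∑ i, ∑ j, if i < j then f i j else 0 := by
    rw [sum_filter, ← univ_product_univ, sum_product]
  have hs' : ∑ i, ∑ j, (if i < j then f i j else 0) = ∑ i, ∑ j, if j < i then f i j else 0 := by
    rw [sum_comm]
    exact sum_congr rfl fun i _ => sum_congr rfl fun j _ => by rw [hf]
  have hd : ∑ i, f i i = ∑ i, ∑ j, if i = j then f i j else 0 := by simp
  rw [two_mul, hs]
  nth_rewrite 2 [hs']
  rw [hd]
  simp_rw [← sum_add_distrib]
  refine sum_congr rfl fun i _ => sum_congr rfl fun j _ => ?_
  rcases lt_trichotomy i j with h | h | h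
  · simp [h, h.ne, h.not_gt]
  · simp [h]
  · simp [h, h.ne', h.not_gt]

theorem sum_diag_le_sum_sum {ι : Type*} [Fintype ι] [DecidableEq ι] (F : ι → ι → ℤ)
    (hF : ∀ i j, i ≠ j → 0 ≤ F i j) : ∑ i, F i i ≤ ∑ i, ∑ j, F i j := by
  refine sum_le_sum fun i _ => ?_
  rw [← add_sum_erase univ (F i) (mem_univ i)]
  exact le_add_of_nonneg_right (sum_nonneg fun j hj => hF i j (ne_of_mem_erase hj).symm)

theorem four_le_sq {u : ℤ} (h : u % 4 = 2) : 4 ≤ u ^ 2 := by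
  rcases (by omega : u ≤ -2 ∨ 2 ≤ u) with h | h <;> nlinarith

theorem eight_mul_sub_le_sq {u : ℤ} (h : u % 4 = 2) : 8 * u - 12 ≤ u ^ 2 := by
  rcases (by omega : u ≤ 2 ∨ 6 ≤ u) with h | h <;> nlinarith

theorem four_mul_le_sq {u : ℤ} (h : u % 4 = 0) : 4 * u ≤ u ^ 2 := by
  rcases (by omega : u ≤ 0 ∨ 4 ≤ u) with h | h <;> nlinarith

section TwoClass

variable {ι : Type*} [Fintype ι] [DecidableEq ι] {U : ι → ι → ℤ} {β : ι → ℤ}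

/-- Bound for arrays whose off-diagonal entries are `2` modulo `4` within the classes
of `β` and `0` modulo `4` across them. -/
theorem two_class_bound {K : ℤ} (hβ : ∀ i, β i = 0 ∨ β i = 1)
    (hsame : ∀ i j, β i = β j → U i j % 4 = 2) (hdiag : ∀ i, U i i = K) :
    Fintype.card ι * K ^ 2 + 2 * (Fintype.card ι : ℤ) ^ 2 - 4 * Fintype.card ι
      ≤ ∑ i, ∑ j, U i j ^ 2 := by
  have key := sum_diag_le_sum_sum
    (fun i j => U i j ^ 2 - 4 * ((1 - β i) * (1 - β j) + β i * β j)) fun i j _ => by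
      rcases hβ i with hi | hi <;> rcases hβ j with hj | hj <;> simp only [hi, hj]
      · linarith [four_le_sq (hsame i j (by rw [hi, hj]))]
      · nlinarith [sq_nonneg (U i j)]
      · nlinarith [sq_nonneg (U i j)]
      · linarith [four_le_sq (hsame i j (by rw [hi, hj]))]
  have e1 : ∑ i, (U i i ^ 2 - 4 * ((1 - β i) * (1 - β i) + β i * β i))
      = Fintype.card ι * (K ^ 2 - 4) := by
    have : ∀ i, U i i ^ 2 - 4 * ((1 - β i) * (1 - β i) + β i * β i) = K ^ 2 - 4 := fun i => by
      rw [hdiag]; rcases hβ i with hi | hi <;> simp [hi]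
    simp only [this, sum_const, card_univ, nsmul_eq_mul]
  have e2 : ∑ i, ∑ j, (U i j ^ 2 - 4 * ((1 - β i) * (1 - β j) + β i * β j))
      = ∑ i, ∑ j, U i j ^ 2
        - 4 * ((Fintype.card ι - ∑ i, β i) ^ 2 + (∑ i, β i) ^ 2) := by
    have h1 : ((Fintype.card ι : ℤ) - ∑ i, β i) = ∑ i, (1 - β i) := by simp
    rw [h1, sq (∑ i, (1 - β i)), sq (∑ i, β i), sum_mul_sum, sum_mul_sum]
    simp_rw [sum_sub_distrib, ← mul_sum, sum_add_distrib, ← mul_sum]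
  rw [e1, e2] at key
  nlinarith [sq_nonneg ((Fintype.card ι : ℤ) - 2 * ∑ i, β i)]

/-- Bound for symmetric arrays with constant row sums, obtained by weighting the rows
of the class `β = 1`. -/
theorem two_class_weighted_bound {K s σ : ℤ} (hσ : σ = 1 ∨ σ = -1)
    (hβ : ∀ i, β i = 0 ∨ β i = 1)
    (hsame : ∀ i j, β i = β j → U i j % 4 = 2) (hcross : ∀ i j, β i ≠ β j → U i j % 4 = 0)
    (hdiag : ∀ i, U i i = K) (hsymm : ∀ i j, U i j = U j i) (hrow : ∀ i, ∑ j, U i j = s) :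
    Fintype.card ι * K ^ 2 + 8 * (∑ i, β i) * (σ * (s - K))
        + 4 * (Fintype.card ι - ∑ i, β i) * (Fintype.card ι - ∑ i, β i - 1)
        - 12 * (∑ i, β i) * (∑ i, β i - 1)
      ≤ ∑ i, ∑ j, U i j ^ 2 := by
  have hsq : ∀ u : ℤ, (σ * u) ^ 2 = u ^ 2 := fun u => by rcases hσ with h | h <;> simp [h]
  have hm2 : ∀ u : ℤ, u % 4 = 2 → (σ * u) % 4 = 2 := fun u hu => by
    rcases hσ with h | h <;> subst h <;> omega
  have hm0 : ∀ u : ℤ, u % 4 = 0 → (σ * u) % 4 = 0 := fun u hu => by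
    rcases hσ with h | h <;> subst h <;> omega
  have key := sum_diag_le_sum_sum
    (fun i j => U i j ^ 2 - 4 * σ * (β i * U i j + β j * U j i)
      - 4 * ((1 - β i) * (1 - β j)) + 12 * (β i * β j)) fun i j _ => by
      simp only [hsymm j i]
      rw [← hsq (U i j)]
      rcases hβ i with hi | hi <;> rcases hβ j with hj | hj <;> simp only [hi, hj]
      · linarith [four_le_sq (hm2 _ (hsame i j (by rw [hi, hj])))]
      · linarith [four_mul_le_sq (hm0 _ (hcross i j (by simp [hi, hj])))]
      · linarith [four_mul_le_sq (hm0 _ (hcross i j (by simp [hi, hj])))]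
      · linarith [eight_mul_sub_le_sq (hm2 _ (hsame i j (by rw [hi, hj])))]
  have h1 : ((Fintype.card ι : ℤ) - ∑ i, β i) = ∑ i, (1 - β i) := by simp
  have e1 : ∑ i, (U i i ^ 2 - 4 * σ * (β i * U i i + β i * U i i)
      - 4 * ((1 - β i) * (1 - β i)) + 12 * (β i * β i))
      = Fintype.card ι * K ^ 2 - 8 * σ * K * ∑ i, β i
        - 4 * (Fintype.card ι - ∑ i, β i) + 12 * ∑ i, β i := by
    have : ∀ i, U i i ^ 2 - 4 * σ * (β i * U i i + β i * U i i)
        - 4 * ((1 - β i) * (1 - β i)) + 12 * (β i * β i)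
        = K ^ 2 - 8 * σ * K * β i - 4 * (1 - β i) + 12 * β i := fun i => by
      rw [hdiag]; rcases hβ i with hi | hi <;> simp only [hi] <;> ring
    rw [h1]
    simp_rw [this, sum_add_distrib, sum_sub_distrib, ← mul_sum]
    simp
  have e2 : ∑ i, ∑ j, (U i j ^ 2 - 4 * σ * (β i * U i j + β j * U j i)
      - 4 * ((1 - β i) * (1 - β j)) + 12 * (β i * β j))
      = ∑ i, ∑ j, U i j ^ 2 - 8 * σ * (s * ∑ i, β i)
        - 4 * (Fintype.card ι - ∑ i, β i) ^ 2 + 12 * (∑ i, β i) ^ 2 := by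
    have h2 : ∑ i, ∑ j, β i * U i j = s * ∑ i, β i := by
      simp_rw [← mul_sum, hrow, ← sum_mul, mul_comm]
    have h3 : ∑ i, ∑ j, β j * U j i = s * ∑ i, β i := by rw [sum_comm, h2]
    rw [h1, sq (∑ i, (1 - β i)), sq (∑ i, β i), sum_mul_sum, sum_mul_sum]
    simp_rw [sum_add_distrib, sum_sub_distrib, ← mul_sum, sum_add_distrib]
    simp_rw [← mul_sum] at h2 h3 ⊢
    rw [h2, h3]
    ring
  rw [e1, e2] at key
  linarith

end TwoClass

/-- The rows of a sign matrix split into two classes that determine their inner products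
modulo `4`. -/
theorem exists_row_classes {ι κ : Type*} [Fintype κ] (X : Matrix ι κ ℤ)
    (hpm : ∀ i j, X i j = 1 ∨ X i j = -1) :
    ∃ β : ι → ℤ, (∀ i, β i = 0 ∨ β i = 1) ∧
      ∀ i i', (∑ j, X i j * X i' j) % 4 = (Fintype.card κ + 2 * (β i + β i')) % 4 := by
  have hpar : ∀ i, (2 : ℤ) ∣ ∑ j, X i j - Fintype.card κ := fun i => by
    have : ∑ j, X i j - (Fintype.card κ : ℤ) = ∑ j, (X i j - 1) := by simp
    rw [this]
    refine dvd_sum fun j _ => ?_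
    rcases hpm i j with h | h <;> rw [h] <;> decide
  have hprod : ∀ i i', (4 : ℤ) ∣ ∑ j, X i j * X i' j
      - (∑ j, X i j + ∑ j, X i' j - Fintype.card κ) := fun i i' => by
    have : ∑ j, X i j * X i' j - (∑ j, X i j + ∑ j, X i' j - (Fintype.card κ : ℤ))
        = ∑ j, (X i j * X i' j - (X i j + X i' j - 1)) := by
      simp [sum_add_distrib, sum_sub_distrib]
    rw [this]
    refine dvd_sum fun j _ => ?_
    rcases hpm i j with h | h <;> rcases hpm i' j with h' | h' <;> rw [h, h'] <;> decide
  refine ⟨fun i => ((∑ j, X i j - Fintype.card κ) / 2) % 2, fun i => Int.emod_two_eq_zero_or_one _, fun i i' => ?_⟩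
  have h1 := hpar i
  have h2 := hpar i'
  have h3 := hprod i i'
  dsimp only
  omega

theorem sum_eq_zero_of_balanced {N : ℕ} (hN : N % 4 = 0) (x : Fin N → ℤ)
    (hx : ∀ i, x i = 1 ∨ x i = -1) (hbal : (univ.filter fun i => x i = 1).card = N / 2) :
    ∑ i, x i = 0 := by
  have h : ∀ i, x i = 2 * (if x i = 1 then 1 else 0) - 1 := fun i => by
    rcases hx i with h | h <;> simp [h]
  rw [sum_congr rfl fun i _ => h i, sum_sub_distrib, ← mul_sum, sum_boole, hbal]
  simp
  omega

/-- Sum-of-squares bounds for two-class arrays, in terms of `|K - s|`, the absolute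
off-diagonal row sum. -/
theorem sum_sq_two_class_bounds {N : ℕ} {U : Fin N → Fin N → ℤ} {β : Fin N → ℤ} {K s : ℤ}
    (hβ : ∀ i, β i = 0 ∨ β i = 1)
    (hsame : ∀ i j, β i = β j → U i j % 4 = 2) (hcross : ∀ i j, β i ≠ β j → U i j % 4 = 0)
    (hdiag : ∀ i, U i i = K) (hsymm : ∀ i j, U i j = U j i) (hrow : ∀ i, ∑ j, U i j = s) :
    (2 * |K - s| ≤ 3 * N - 4 →
      N * K ^ 2 - 2 * (N : ℤ) ^ 2 + 4 * N + 4 * N * |K - s| ≤ ∑ i, ∑ j, U i j ^ 2) ∧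
    (3 * N - 4 ≤ 2 * |K - s| →
      N * K ^ 2 + 4 * (N : ℤ) ^ 2 - 4 * N ≤ ∑ i, ∑ j, U i j ^ 2) := by
  obtain ⟨σ, hσ, hσK⟩ : ∃ σ : ℤ, (σ = 1 ∨ σ = -1) ∧ σ * (s - K) = |K - s| := by
    rcases abs_cases (K - s) with ⟨h, -⟩ | ⟨h, -⟩
    · exact ⟨-1, Or.inr rfl, by rw [h]; ring⟩
    · exact ⟨1, Or.inl rfl, by rw [h]; ring⟩
  have main : ∃ b : ℤ, 0 ≤ b ∧ 2 * b ≤ N ∧ N * K ^ 2 + 8 * b * |K - s|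
      + 4 * (N - b) * (N - b - 1) - 12 * b * (b - 1) ≤ ∑ i, ∑ j, U i j ^ 2 := by
    have h0 : 0 ≤ ∑ i, β i := sum_nonneg fun i _ => by rcases hβ i with h | h <;> simp [h]
    have h1 : ∑ i, (1 - β i) = N - ∑ i, β i := by simp
    have h2 : 0 ≤ ∑ i, (1 - β i) :=
      sum_nonneg fun i _ => by rcases hβ i with h | h <;> simp [h]
    rcases le_total (2 * ∑ i, β i) (N : ℤ) with h | h
    · refine ⟨_, h0, h, ?_⟩
      simpa [hσK] using two_class_weighted_bound hσ hβ hsame hcross hdiag hsymm hrow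
    · refine ⟨_, h2, by omega, ?_⟩
      have := two_class_weighted_bound (β := fun i => 1 - β i) hσ
        (fun i => by rcases hβ i with h | h <;> simp [h])
        (fun i j hij => hsame i j (by linarith)) (fun i j hij => hcross i j
          fun h => hij (by rw [h])) hdiag hsymm hrow
      simpa only [hσK, Fintype.card_fin] using this
  obtain ⟨b, hb0, hb, hle⟩ := main
  constructor
  · intro hD
    nlinarith [mul_nonneg (by linarith : (0 : ℤ) ≤ N - 2 * b)
      (by linarith : (0 : ℤ) ≤ 3 * N + 2 * b - 4 - 2 * |K - s|)]
  · intro hD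
    nlinarith [mul_nonneg hb0 (by linarith : (0 : ℤ) ≤ 2 * |K - s| - (3 * N - 4)),
      mul_nonneg hb0 (by linarith : (0 : ℤ) ≤ N - 2 * b)]


/-- Theorem 3.1, part 1 (`N ≡ 0 (mod 4)`): improved lower bounds for `E(s²)`.
With `q` the unique integer satisfying `-2N+2 < m - q(N-1) < 2N-2` and
`m + q ≡ 2 (mod 4)`, and `g(q) = (m+q)²N - q²N² - mN²`, every `N`-run
supersaturated design with `m` factors satisfies the three stated bounds
according to the size of `|m - q(N-1)|`. -/
theorem stmt_18 (N m : ℕ) (q : ℤ) (hN : N % 4 = 0) (hm : N - 1 < m)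
    (hq1 : -2 * (N : ℤ) + 2 < (m : ℤ) - q * ((N : ℤ) - 1))
    (hq2 : (m : ℤ) - q * ((N : ℤ) - 1) < 2 * (N : ℤ) - 2)
    (hq3 : ((m : ℤ) + q) % 4 = 2)
    (X : Matrix (Fin N) (Fin m) ℤ)
    (hpm : ∀ i j, X i j = 1 ∨ X i j = -1)
    (hbal : ∀ j, (Finset.univ.filter (fun i => X i j = 1)).card = N / 2)
    (hdist : ∀ j j' : Fin m, j ≠ j' →
      (∃ i, X i j ≠ X i j') ∧ (∃ i, X i j ≠ -X i j'))
    (E M g : ℝ)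
    (hE : E = (∑ p ∈ (Finset.univ : Finset (Fin m × Fin m)).filter
        (fun p => p.1 < p.2), ((∑ k, X k p.1 * X k p.2 : ℤ) : ℝ) ^ 2)
        / (m.choose 2))
    (hM : M = |(m : ℝ) - (q : ℝ) * ((N : ℝ) - 1)|)
    (hg : g = ((m : ℝ) + (q : ℝ)) ^ 2 * N - (q : ℝ) ^ 2 * (N : ℝ) ^ 2
        - (m : ℝ) * (N : ℝ) ^ 2) :
    (M < (N : ℝ) - 1 →
      E ≥ (g + 2 * (N : ℝ) ^ 2 - 4 * N) / ((m : ℝ) * ((m : ℝ) - 1))) ∧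
    ((N : ℝ) - 1 < M ∧ M ≤ 3 / 2 * (N : ℝ) - 2 →
      E ≥ (g - 2 * (N : ℝ) ^ 2 + 4 * N + 4 * N * M) / ((m : ℝ) * ((m : ℝ) - 1))) ∧
    (M > 3 / 2 * (N : ℝ) - 2 →
      E ≥ (g + 4 * (N : ℝ) ^ 2 - 4 * N) / ((m : ℝ) * ((m : ℝ) - 1))) := by
  set S : ℤ := ∑ p ∈ (univ : Finset (Fin m × Fin m)).filter (fun p => p.1 < p.2),
    (∑ k, X k p.1 * X k p.2) ^ 2 with hS
  have hsq1 : ∀ i j, X i j * X i j = 1 := fun i j => by rcases hpm i j with h | h <;> simp [h]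
  obtain ⟨β, hβ, hmod⟩ := exists_row_classes X hpm
  simp only [Fintype.card_fin] at hmod
  set U : Fin N → Fin N → ℤ := fun i i' => ∑ j, X i j * X i' j + q with hU
  have hsame : ∀ i j, β i = β j → U i j % 4 = 2 := fun i j hij => by
    have := hmod i j
    simp only [hU]
    omega
  have hcross : ∀ i j, β i ≠ β j → U i j % 4 = 0 := fun i j hij => by
    have := hmod i j
    have := hβ i
    have := hβ j
    simp only [hU]
    omega
  have hdiag : ∀ i, U i i = m + q := fun i => by simp [hU, hsq1]
  have hsymm : ∀ i j, U i j = U j i := fun i j => by simp only [hU, mul_comm]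
  have hrowT : ∀ i, ∑ i', ∑ j, X i j * X i' j = 0 := fun i => by
    rw [sum_comm]
    refine sum_eq_zero fun j _ => ?_
    rw [← mul_sum, sum_eq_zero_of_balanced hN (fun i => X i j) (fun i => hpm i j) (hbal j),
      mul_zero]
  have hrow : ∀ i, ∑ j, U i j = N * q := fun i => by
    simp [hU, sum_add_distrib, hrowT]
  have hUS : ∑ i, ∑ j, U i j ^ 2 = 2 * S + m * N ^ 2 + q ^ 2 * N ^ 2 := by
    have hgram := sum_sum_eq_diag_add_two_mul
      (fun j j' : Fin m => (∑ k, X k j * X k j') ^ 2) (fun j j' => by simp only [mul_comm])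
    rw [sum_sq_gram_comm] at hgram
    simp only [hsq1, sum_const, card_univ, Fintype.card_fin, nsmul_eq_mul, mul_one] at hgram
    have : ∀ i j, U i j ^ 2
        = (∑ k, X i k * X j k) ^ 2 + 2 * q * (∑ k, X i k * X j k) + q ^ 2 := fun i j => by
      simp only [hU]; ring
    simp_rw [this, sum_add_distrib, ← mul_sum, hrowT, hgram]
    simp [hS]
    ring
  have hNpos : 4 ≤ N := by
    rcases Nat.eq_zero_or_pos N with h | h
    · subst h; push_cast at hq1 hq2; omega
    · omega
  have hmm : (0 : ℝ) < (m : ℝ) * ((m : ℝ) - 1) := by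
    have : (4 : ℝ) ≤ m := by exact_mod_cast (by omega : 4 ≤ m)
    nlinarith
  have hES : E = 2 * S / ((m : ℝ) * ((m : ℝ) - 1)) := by
    rw [hE, Nat.cast_choose_two, hS]
    push_cast
    field_simp
  have hKs : |((m : ℤ) + q) - N * q| = |(m : ℤ) - q * ((N : ℤ) - 1)| := by congr 1; ring
  have hM' : M = ((|((m : ℤ) + q) - N * q| : ℤ) : ℝ) := by rw [hKs, hM]; push_cast; rfl
  have b1 := two_class_bound hβ hsame hdiag
  obtain ⟨b2, b3⟩ := sum_sq_two_class_bounds hβ hsame hcross hdiag hsymm hrow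
  rw [hUS] at b1 b2 b3
  rw [Fintype.card_fin] at b1
  generalize |((m : ℤ) + q) - N * q| = D at b2 b3 hM'
  rw [hES, hg, hM']
  refine ⟨fun _ => ?_, fun h => ?_, fun h => ?_⟩ <;>
    refine div_le_div_of_nonneg_right ?_ hmm.le
  · have b1' := (Int.cast_le (R := ℝ)).2 b1
    push_cast at b1'
    linarith
  · have hD : (((2 * D : ℤ)) : ℝ) ≤ ((3 * N - 4 : ℤ) : ℝ) := by push_cast; linarith [h.2]
    have b2' := (Int.cast_le (R := ℝ)).2 (b2 (Int.cast_le.1 hD))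
    push_cast at b2'
    linarith
  · have hD : ((3 * N - 4 : ℤ) : ℝ) ≤ (((2 * D : ℤ)) : ℝ) := by push_cast; linarith
    have b3' := (Int.cast_le (R := ℝ)).2 (b3 (Int.cast_le.1 hD))
    push_cast at b3'
    linarith
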